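/- Under the standing hypotheses (a seven-term arithmetic progression a, a+d, ..., a+6d in S with d ≥ 1 and 3^9 ≤ a+6d), the common difference d is divisible by 3. -/

import Mathlib

lemma not_three_dvd_two_pow (k : ℕ) : ¬ 3 ∣ 2 ^ k := fun h =>
  absurd (Nat.prime_three.dvd_of_dvd_pow h) (by norm_num)

/-- A multiple of three of the form `3 ^ x + 2 ^ y` has `x = 0`. -/
lemma eq_one_add_two_pow_of_three_dvd {t : ℕ} (h : ∃ x y : ℕ, t = 3 ^ x + 2 ^ y) (h3 : 3 ∣ t) :
    ∃ y : ℕ, t = 1 + 2 ^ y := by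
  obtain ⟨x, y, rfl⟩ := h
  rcases Nat.eq_zero_or_pos x with rfl | hx
  · exact ⟨y, by simp⟩
  · exact absurd ((Nat.dvd_add_right (dvd_pow_self 3 hx.ne')).mp h3) (not_three_dvd_two_pow y)

lemma two_mul_two_pow_le_of_two_pow_lt {p q : ℕ} (h : 2 ^ p < 2 ^ q) : 2 * 2 ^ p ≤ 2 ^ q := by
  rw [← pow_succ']
  exact Nat.pow_le_pow_right two_pos ((Nat.pow_lt_pow_iff_right one_lt_two).mp h)

/-- Two powers of two whose positive difference is a multiple of three differ by a factor of at
least four. -/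
lemma two_pow_le_of_two_pow_add_three_mul {p q d : ℕ} (hd : 0 < d) (h : 2 ^ p + 3 * d = 2 ^ q) :
    2 ^ p ≤ d := by
  have hlt : 2 ^ p < 2 ^ q := by omega
  have hle := two_mul_two_pow_le_of_two_pow_lt hlt
  have hne : 2 ^ (p + 1) ≠ 2 ^ q := fun he =>
    not_three_dvd_two_pow p ⟨d, by rw [pow_succ] at he; omega⟩
  have := two_mul_two_pow_le_of_two_pow_lt (p := p + 1) (q := q) (by rw [pow_succ] at *; omega)
  rw [pow_succ] at this
  omega

/-- Under the standing hypotheses, the common difference d is divisible by 3. -/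
theorem three_dvd_d (a d m n : ℕ)
    (ha : 0 < a) (hd : 0 < d)
    (hAP : ∀ i : ℕ, i ≤ 6 → ∃ x y : ℕ, a + i * d = 3 ^ x + 2 ^ y)
    (hbig : 3 ^ 9 ≤ a + 6 * d)
    (hm₁ : 3 ^ m ≤ a + 6 * d) (hm₂ : a + 6 * d < 3 ^ (m + 1))
    (hn₁ : 2 ^ n ≤ a + 6 * d) (hn₂ : a + 6 * d < 2 ^ (n + 1)) :
    3 ∣ d := by
  by_contra hnd
  have key (i : ℕ) (hi : i ≤ 6) (h3 : 3 ∣ a + i * d) : ∃ y : ℕ, a + i * d = 1 + 2 ^ y :=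
    eq_one_add_two_pow_of_three_dvd (hAP i hi) h3
  have ha2 : 2 ≤ a := by
    obtain ⟨x, y, h⟩ := hAP 0 (by norm_num)
    have := Nat.pow_pos (n := x) (show 0 < 3 by norm_num)
    have := Nat.pow_pos (n := y) (show 0 < 2 by norm_num)
    omega
  have hcases : 3 ∣ a + 0 * d ∨ 3 ∣ a + 1 * d ∨ 3 ∣ a + 2 * d := by
    have hd3 : d % 3 = 1 ∨ d % 3 = 2 := by omega
    have ha3 : a % 3 = 0 ∨ a % 3 = 1 ∨ a % 3 = 2 := by omega
    omega
  rcases hcases with h | h | h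
  · obtain ⟨p, hp⟩ := key 0 (by norm_num) h
    obtain ⟨q, hq⟩ := key 3 (by norm_num) (by omega)
    obtain ⟨r, hr⟩ := key 6 (by norm_num) (by omega)
    have := two_mul_two_pow_le_of_two_pow_lt (p := q) (q := r) (by omega)
    omega
  · obtain ⟨p, hp⟩ := key 1 (by norm_num) h
    obtain ⟨q, hq⟩ := key 4 (by norm_num) (by omega)
    have := two_pow_le_of_two_pow_add_three_mul (p := p) (q := q) hd (by omega)
    omega
  · obtain ⟨p, hp⟩ := key 2 (by norm_num) h
    obtain ⟨q, hq⟩ := key 5 (by norm_num) (by omega)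
    have := two_pow_le_of_two_pow_add_three_mul (p := p) (q := q) hd (by omega)
    omega
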